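/- Let G be a finite group. There exists a class c ∈ Ĥ^1(G, I_G) (represented by the 1-cocycle g ↦ 1−g) such that for every G-module X and every i ∈ ℤ, the cup-product maps (−∪c) : Ĥ^i(G, Hom_ℤ(X, Hom_ℤ(I_G, A))) → Ĥ^{i+1}(G, Hom_ℤ(X, A)) assemble into a natural isomorphism of functors Ĥ^i(G, Hom_ℤ(X, Hom_ℤ(I_G, −))) ⇒ Ĥ^{i+1}(G, Hom_ℤ(X, −)) on the category of G-modules. -/

import Mathlib

/-!
This file sets up Tate cohomology of a finite group `G` (with coefficients in objects of
`Rep ℤ G`), realized concretely in each degree `n ∈ ℤ` as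
`Ĥ^n(G, M) = Ĥ⁰(G, Hom_ℤ(J n, M))`, where `J n` is the standard `n`-th syzygy of the
trivial module `ℤ` (the `n`-th tensor power of the augmentation ideal `I_G` for `n ≥ 0`,
and of its `ℤ`-linear dual for `n < 0`), and `Ĥ⁰` denotes invariants modulo norms.
Cup products are induced by the canonical comparison maps `J (i+j) ⟶ J i ⊗ J j`.
-/

open CategoryTheory MonoidalCategory TensorProduct

set_option linter.unusedSectionVars false
set_option maxHeartbeats 1000000

attribute [instance 0] AddCommGroup.toIntModule

namespace Enc

/-- A `G`-action on `H` induces a representation `G →* End(k[H])` in the natural way,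
with `k[H]` realized as `H →₀ k`. -/
noncomputable def ofMulAction (k : Type*) [CommSemiring k] (G : Type*) [Monoid G] (H : Type*)
    [MulAction G H] : Representation k G (H →₀ k) where
  toFun g := Finsupp.lmapDomain k k (g • ·)
  map_one' := by
    ext x y
    simp
  map_mul' x y := by
    ext z w
    simp [mul_smul]

theorem ofMulAction_def {k : Type*} [CommSemiring k] {G : Type*} [Monoid G] {H : Type*}
    [MulAction G H] (g : G) : ofMulAction k G H g = Finsupp.lmapDomain k k (g • ·) :=
  rfl

variable {k : Type} [CommRing k] {G : Type} [Group G] [Fintype G]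

/-! ### Degree-zero Tate cohomology: invariants modulo norms -/

section Aux
variable {V V₂ : Type} [AddCommGroup V] [Module k V] [AddCommGroup V₂] [Module k V₂]

/-- The norm map `v ↦ ∑_{g ∈ G} g • v` of a representation. -/
noncomputable def rnorm (ρ : Representation k G V) : V →ₗ[k] V := ∑ g : G, ρ g

lemma rnorm_mem_invariants (ρ : Representation k G V) (v : V) :
    rnorm ρ v ∈ ρ.invariants := by
  intro g
  show (ρ g) ((∑ h : G, ρ h) v) = _
  simp only [LinearMap.sum_apply, map_sum]
  rw [Fintype.sum_equiv (Equiv.mulLeft g) _ (fun h => ρ h v) (fun h => by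
    rw [← Module.End.mul_apply, ← map_mul]; rfl)]
  simp [rnorm]

/-- The norm map, viewed as landing in the invariants. -/
noncomputable def rnormRes (ρ : Representation k G V) : V →ₗ[k] ρ.invariants :=
  (rnorm ρ).codRestrict ρ.invariants (rnorm_mem_invariants ρ)

/-- The image of the norm map, inside the invariants. -/
noncomputable def rnormIm (ρ : Representation k G V) : Submodule k ρ.invariants :=
  LinearMap.range (rnormRes ρ)

/-- Degree-zero Tate cohomology of a representation: invariants modulo norms. -/
noncomputable def tate0 (ρ : Representation k G V) : Type :=
  ρ.invariants ⧸ rnormIm ρ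

noncomputable instance (ρ : Representation k G V) : AddCommGroup (tate0 ρ) :=
  inferInstanceAs (AddCommGroup (ρ.invariants ⧸ rnormIm ρ))

noncomputable instance (ρ : Representation k G V) : Module k (tate0 ρ) :=
  inferInstanceAs (Module k (ρ.invariants ⧸ rnormIm ρ))

/-- The Tate class of an invariant vector. -/
noncomputable def tate0mk {ρ : Representation k G V} (v : V) (hv : v ∈ ρ.invariants) :
    tate0 ρ := Submodule.Quotient.mk (⟨v, hv⟩ : ρ.invariants)

lemma invariants_comp {ρ : Representation k G V} {σ : Representation k G V₂}
    (f : V →ₗ[k] V₂) (hf : ∀ (g : G) (v : V), f (ρ g v) = σ g (f v)) :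
    ∀ x ∈ ρ.invariants, f x ∈ σ.invariants := by
  intro x hx g
  rw [← hf g x, hx g]

/-- Functoriality of degree-zero Tate cohomology along equivariant maps. -/
noncomputable def tate0map {ρ : Representation k G V} {σ : Representation k G V₂}
    (f : V →ₗ[k] V₂) (hf : ∀ (g : G) (v : V), f (ρ g v) = σ g (f v)) :
    tate0 ρ →ₗ[k] tate0 σ :=
  Submodule.mapQ (rnormIm ρ) (rnormIm σ) (f.restrict (invariants_comp f hf))
    (by
      rintro ⟨x, hx⟩ ⟨y, hy⟩
      refine ⟨f y, ?_⟩
      apply Subtype.ext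
      have hy' := congrArg Subtype.val hy
      show rnorm σ (f y) = _
      simp only [LinearMap.restrict_apply]
      have : rnorm σ (f y) = f (rnorm ρ y) := by
        simp only [rnorm, LinearMap.sum_apply, map_sum]
        exact Finset.sum_congr rfl fun g _ => (hf g y).symm
      rw [this]
      exact congrArg f hy')

end Aux

/-- Degree-zero Tate cohomology `Ĥ⁰(G, W) = W^G / N_G W` of an object of `Rep k G`. -/
noncomputable def H0T (W : Rep k G) : Type := tate0 W.ρ

noncomputable instance (W : Rep k G) : AddCommGroup (H0T W) :=
  inferInstanceAs (AddCommGroup (tate0 W.ρ))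

noncomputable instance (W : Rep k G) : Module k (H0T W) :=
  inferInstanceAs (Module k (tate0 W.ρ))

/-- Functoriality of `Ĥ⁰` along morphisms of representations. -/
noncomputable def H0Tmap {W W' : Rep k G} (ψ : W ⟶ W') : H0T W →ₗ[k] H0T W' :=
  tate0map ψ.hom (fun g v => Rep.hom_comm_apply ψ g v)

/-! ### The augmentation ideal and the syzygy modules `J n` -/

variable (G)

/-- The augmentation map `ℤ[G] → ℤ`. -/
noncomputable def aug : (G →₀ ℤ) →ₗ[ℤ] ℤ :=
  Finsupp.linearCombination ℤ (fun _ : G => (1 : ℤ))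

lemma aug_comm (g : G) (x : G →₀ ℤ) :
    aug G (ofMulAction ℤ G G g x) = aug G x := by
  unfold aug
  simp [ofMulAction_def, Finsupp.linearCombination_apply]
  rw [Finsupp.sum_mapDomain_index] <;> simp

/-- The underlying `ℤ`-module of the augmentation ideal. -/
noncomputable abbrev IGcar : Type := LinearMap.ker (aug G)

/-- The representation of `G` on the augmentation ideal. -/
noncomputable def IGρ : Representation ℤ G (IGcar G) where
  toFun g := (ofMulAction ℤ G G g).restrict (p := LinearMap.ker (aug G))
    (q := LinearMap.ker (aug G)) (by
      intro x hx
      simp only [LinearMap.mem_ker] at hx ⊢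
      rw [aug_comm]; exact hx)
  map_one' := by ext x; simp [LinearMap.restrict_apply]
  map_mul' g h := by ext x; simp [LinearMap.restrict_apply, Module.End.mul_apply]

/-- The augmentation ideal `I_G` of `ℤ[G]`, as an object of `Rep ℤ G`. -/
noncomputable def IGrep : Rep ℤ G := Rep.of (IGρ G)

/-- `Hom_ℤ(X, A)` with the conjugation `G`-action, i.e. the internal hom in `Rep ℤ G`. -/
noncomputable abbrev hRep {G : Type} [Group G] (X A : Rep.{0} ℤ G) : Rep.{0} ℤ G :=
  (Rep.ihom X).obj A

/-- The `ℤ`-linear dual of the augmentation ideal, as an object of `Rep ℤ G`. -/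
noncomputable def DIG : Rep ℤ G := hRep (IGrep G) (𝟙_ (Rep ℤ G))

instance : Module.Finite ℤ (IGcar G) := by
  have : Module.Finite ℤ (G →₀ ℤ) :=
    Module.Finite.equiv (Finsupp.linearEquivFunOnFinite ℤ ℤ G).symm
  exact Module.Finite.of_injective (LinearMap.ker (aug G)).subtype Subtype.val_injective

instance : Module.Free ℤ (IGcar G) := by infer_instance

/-- Nonnegative tensor powers `I_G^{⊗ n}` (with `I_G^{⊗ 0} = ℤ`). -/
noncomputable def Jp : ℕ → Rep ℤ G
  | 0 => 𝟙_ (Rep ℤ G)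
  | n + 1 => Jp n ⊗ IGrep G

/-- Tensor powers of the dual of the augmentation ideal. -/
noncomputable def Jn : ℕ → Rep ℤ G
  | 0 => 𝟙_ (Rep ℤ G)
  | n + 1 => Jn n ⊗ DIG G

/-- The standard syzygy modules of the trivial representation `ℤ`, indexed by `ℤ`:
`J n = I_G^{⊗ n}` for `n ≥ 0`, and `J n = (I_G^∨)^{⊗ (-n)}` for `n < 0`. -/
noncomputable def J : ℤ → Rep ℤ G
  | .ofNat n => Jp G n
  | .negSucc n => Jn G (n + 1)

lemma J_ofNat (m : ℕ) : J G (m : ℤ) = Jp G m := rfl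

lemma J_neg (m : ℕ) : J G (-(m : ℤ)) = Jn G m := by cases m <;> rfl

/-- The element of `(I_G)^∨ ⊗ I_G` corresponding to the identity map. -/
noncomputable def preElt : Module.Dual ℤ (IGcar G) ⊗[ℤ] IGcar G :=
  (dualTensorHomEquiv ℤ (IGcar G) (IGcar G)).symm LinearMap.id

/-- The canonical element of `I_G ⊗ (I_G)^∨` corresponding to the identity map. -/
noncomputable def coevElt : ((IGrep G ⊗ DIG G).V) :=
  (TensorProduct.comm ℤ _ _) (preElt G)

lemma conj_dualTensor (g : G) (t : Module.Dual ℤ (IGcar G) ⊗[ℤ] IGcar G) :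
    dualTensorHom ℤ _ _ (TensorProduct.map ((DIG G).ρ g) ((IGrep G).ρ g) t)
      = (IGrep G).ρ g ∘ₗ (dualTensorHom ℤ _ _ t) ∘ₗ (IGrep G).ρ g⁻¹ := by
  have key : ∀ (a b : IGcar G →ₗ[ℤ] IGcar G)
      (d : Module.Dual ℤ (IGcar G) →ₗ[ℤ] Module.Dual ℤ (IGcar G)) (_ : ∀ f w, d f w = f (b w))
      (t : Module.Dual ℤ (IGcar G) ⊗[ℤ] IGcar G),
      dualTensorHom ℤ _ _ (TensorProduct.map d a t) = a ∘ₗ (dualTensorHom ℤ _ _ t) ∘ₗ b := by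
    intro a b d hd t
    induction t with
    | zero => simp
    | tmul f v =>
        apply LinearMap.ext
        intro w
        simp only [TensorProduct.map_tmul, dualTensorHom_apply,
          LinearMap.comp_apply, map_smul, hd]
    | add x y hx hy =>
        simp only [map_add, hx, hy, LinearMap.add_comp, LinearMap.comp_add]
  exact key ((IGrep G).ρ g) ((IGrep G).ρ g⁻¹) ((DIG G).ρ g) (fun _ _ => rfl) t

lemma coevElt_invariant (g : G) :
    ((IGrep G ⊗ DIG G).ρ g) (coevElt G) = coevElt G := by
  show TensorProduct.map ((IGrep G).ρ g) ((DIG G).ρ g)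
      ((TensorProduct.comm ℤ _ _) (preElt G)) = _
  refine (TensorProduct.map_comm ((IGrep G).ρ g) ((DIG G).ρ g) (preElt G)).trans ?_
  show (TensorProduct.comm ℤ _ _) (TensorProduct.map ((DIG G).ρ g) ((IGrep G).ρ g) (preElt G))
      = (TensorProduct.comm ℤ _ _) (preElt G)
  congr 1
  apply (dualTensorHomEquiv ℤ (IGcar G) (IGcar G)).injective
  have h2 : dualTensorHom ℤ (IGcar G) (IGcar G) (preElt G) = LinearMap.id :=
    (dualTensorHomEquiv ℤ (IGcar G) (IGcar G)).apply_symm_apply LinearMap.id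
  show dualTensorHom ℤ (IGcar G) (IGcar G)
      (TensorProduct.map ((DIG G).ρ g) ((IGrep G).ρ g) (preElt G))
    = dualTensorHom ℤ (IGcar G) (IGcar G) (preElt G)
  refine (conj_dualTensor G g (preElt G)).trans ?_
  show (IGrep G).ρ g ∘ₗ dualTensorHom ℤ (IGcar G) (IGcar G) (preElt G) ∘ₗ (IGrep G).ρ g⁻¹
      = dualTensorHom ℤ (IGcar G) (IGcar G) (preElt G)
  rw [h2]
  apply LinearMap.ext
  intro v
  exact Representation.self_inv_apply (IGrep G).ρ g v

/-- The coevaluation `ℤ ⟶ I_G ⊗ I_G^∨`. -/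
noncomputable def coev : 𝟙_ (Rep ℤ G) ⟶ IGrep G ⊗ DIG G := Rep.ofHom {
  toLinearMap := LinearMap.toSpanSingleton ℤ _ (coevElt G)
  isIntertwining' := by
    intro g
    apply LinearMap.ext
    intro z
    show LinearMap.toSpanSingleton ℤ _ (coevElt G) ((𝟙_ (Rep ℤ G)).ρ g z)
        = ((IGrep G ⊗ DIG G).ρ g) (LinearMap.toSpanSingleton ℤ _ (coevElt G) z)
    have hz : ((𝟙_ (Rep ℤ G)).ρ g z) = z := rfl
    rw [hz]
    show z • coevElt G = ((IGrep G ⊗ DIG G).ρ g) (z • coevElt G)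
    rw [map_smul, coevElt_invariant] }


variable {G}

/-- One-step comparison `J (n+1) ⟶ J n ⊗ I_G`. -/
noncomputable def sMap : ∀ n : ℤ, J G (n + 1) ⟶ J G n ⊗ IGrep G
  | .ofNat m => 𝟙 (Jp G m ⊗ IGrep G)
  | .negSucc 0 =>
      coev G ≫ (β_ (IGrep G) (DIG G)).hom ≫ ((λ_ (DIG G)).inv ▷ IGrep G)
  | .negSucc (m+1) =>
      (ρ_ (Jn G (m+1))).inv ≫ (Jn G (m+1) ◁ (coev G ≫ (β_ (IGrep G) (DIG G)).hom))
        ≫ (α_ (Jn G (m+1)) (DIG G) (IGrep G)).inv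

/-- One-step comparison `J (n-1) ⟶ J n ⊗ I_G^∨`. -/
noncomputable def tMap : ∀ n : ℤ, J G (n - 1) ⟶ J G n ⊗ DIG G
  | .ofNat 0 => 𝟙 (𝟙_ (Rep ℤ G) ⊗ DIG G)
  | .ofNat (m+1) =>
      eqToHom (congrArg (J G) (show (Int.ofNat (m+1)) - 1 = ((m:ℕ) : ℤ) by
        rw [Int.ofNat_eq_coe]; push_cast; ring)) ≫
      (ρ_ (Jp G m)).inv ≫ (Jp G m ◁ coev G) ≫ (α_ (Jp G m) (IGrep G) (DIG G)).inv
  | .negSucc m => eqToHom (show J G (Int.negSucc m - 1) = J G (Int.negSucc m) ⊗ DIG G from rfl)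

/-- Comparison maps `J (i + m) ⟶ J i ⊗ J m` for `m ≥ 0`. -/
noncomputable def μpos (i : ℤ) : ∀ m : ℕ, J G (i + m) ⟶ J G i ⊗ J G (m : ℤ)
  | 0 => eqToHom (congrArg (J G) (by omega)) ≫ (ρ_ (J G i)).inv
  | m + 1 =>
      eqToHom (congrArg (J G) (show i + ((m:ℕ)+1:ℕ) = (i + m) + 1 by omega))
        ≫ sMap (i + m) ≫ (μpos i m ▷ IGrep G) ≫ (α_ (J G i) (J G (m:ℤ)) (IGrep G)).hom

/-- Comparison maps `J (i - m) ⟶ J i ⊗ J (-m)` for `m ≥ 0`. -/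
noncomputable def μneg (i : ℤ) : ∀ m : ℕ, J G (i - m) ⟶ J G i ⊗ J G (-(m : ℤ))
  | 0 => eqToHom (congrArg (J G) (by omega)) ≫ (ρ_ (J G i)).inv
  | m + 1 =>
      eqToHom (congrArg (J G) (show i - ((m:ℕ)+1:ℕ) = (i - m) - 1 by omega))
        ≫ tMap (i - m) ≫ (μneg i m ▷ DIG G) ≫ (α_ (J G i) (J G (-(m:ℤ))) (DIG G)).hom
        ≫ (J G i ◁ (eqToHom (show J G (-(m:ℤ)) ⊗ DIG G = J G (-((m:ℕ)+1:ℕ)) by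
            rw [J_neg, J_neg]; rfl)))

variable (G)

/-- The canonical comparison map `J (i+j) ⟶ J i ⊗ J j`, implementing the standard stable
equivalences between the syzygies `J`; it induces the cup product on Tate cohomology. -/
noncomputable def μ (i : ℤ) : ∀ j : ℤ, J G (i + j) ⟶ J G i ⊗ J G j
  | .ofNat m => μpos i m
  | .negSucc m =>
      eqToHom (congrArg (J G) (show i + Int.negSucc m = i - ((m+1 : ℕ) : ℤ) by
        rw [Int.negSucc_eq]; push_cast; ring))
        ≫ μneg i (m+1)

variable {G}

/-! ### Tate cohomology in all degrees, functoriality, cup products -/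

/-- Tate cohomology `Ĥ^n(G, M)` of the finite group `G` with coefficients in `M : Rep ℤ G`,
realized as `Ĥ⁰(G, Hom_ℤ(J n, M))` for the standard `n`-th syzygy `J n` of `ℤ`. -/
noncomputable def tate (n : ℤ) (M : Rep ℤ G) : Type := H0T (hRep (J G n) M)

noncomputable instance (n : ℤ) (M : Rep ℤ G) : AddCommGroup (tate n M) :=
  inferInstanceAs (AddCommGroup (H0T (hRep (J G n) M)))

/-- The map on Tate cohomology induced by a morphism of representations. -/
noncomputable def tmap (n : ℤ) {M N : Rep ℤ G} (φ : M ⟶ N) : tate n M → tate n N :=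
  H0Tmap ((Rep.ihom (J G n)).map φ)

/-- Transport of Tate cohomology along an equality of degrees. -/
noncomputable def tcast {i j : ℤ} {M : Rep ℤ G} (h : i = j) (z : tate i M) : tate j M :=
  h ▸ z

lemma hom_invariant {X W : Rep ℤ G} (m : X ⟶ W) :
    m.hom.toLinearMap ∈ (hRep X W).ρ.invariants := by
  intro g
  show W.ρ g ∘ₗ m.hom.toLinearMap ∘ₗ X.ρ g⁻¹ = m.hom.toLinearMap
  ext v
  simp only [LinearMap.comp_apply]
  exact (congrArg (W.ρ g) (Rep.hom_comm_apply m g⁻¹ v)).trans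
    (Representation.self_inv_apply W.ρ g _)

/-- The Tate cohomology class of a `G`-equivariant map `J n ⟶ W`. -/
noncomputable def mkCls {n : ℤ} {W : Rep ℤ G} (m : J G n ⟶ W) : tate n W :=
  tate0mk m.hom.toLinearMap (hom_invariant m)


lemma tensor_rho_eq (M N : Rep ℤ G) (g : G) :
    (M ⊗ N).ρ g = TensorProduct.map (M.ρ g) (N.ρ g) := rfl

lemma cup_invariance {i j : ℤ} {M N : Rep ℤ G}
    (f : ((hRep (J G i) M).ρ.invariants))
    (g : ((hRep (J G j) N).ρ.invariants)) :
    (TensorProduct.map f.1 g.1).comp ((μ G i j).hom.toLinearMap)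
      ∈ (hRep (J G (i + j)) (M ⊗ N)).ρ.invariants := by
  intro gg
  have hf : M.ρ gg ∘ₗ f.1 ∘ₗ (J G i).ρ gg⁻¹ = f.1 := f.2 gg
  have hg : N.ρ gg ∘ₗ g.1 ∘ₗ (J G j).ρ gg⁻¹ = g.1 := g.2 gg
  have hμ : (μ G i j).hom.toLinearMap.comp ((J G (i + j)).ρ gg⁻¹)
      = (TensorProduct.map ((J G i).ρ gg⁻¹) ((J G j).ρ gg⁻¹)).comp (μ G i j).hom.toLinearMap := by
    have h := (μ G i j).hom.isIntertwining' gg⁻¹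
    exact h
  show (M ⊗ N).ρ gg ∘ₗ ((TensorProduct.map f.1 g.1).comp (μ G i j).hom.toLinearMap)
        ∘ₗ (J G (i + j)).ρ gg⁻¹
      = (TensorProduct.map f.1 g.1).comp (μ G i j).hom.toLinearMap
  have key : ∀ (f' : (J G i).V →ₗ[ℤ] M.V) (g' : (J G j).V →ₗ[ℤ] N.V)
      (_ : M.ρ gg ∘ₗ f' ∘ₗ (J G i).ρ gg⁻¹ = f') (_ : N.ρ gg ∘ₗ g' ∘ₗ (J G j).ρ gg⁻¹ = g'),
      TensorProduct.map (M.ρ gg) (N.ρ gg) ∘ₗ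
          ((TensorProduct.map f' g').comp (μ G i j).hom.toLinearMap) ∘ₗ (J G (i + j)).ρ gg⁻¹
        = (TensorProduct.map f' g').comp (μ G i j).hom.toLinearMap := by
    intro f' g' hf' hg'
    rw [LinearMap.comp_assoc, hμ, ← LinearMap.comp_assoc,
      ← LinearMap.comp_assoc, ← TensorProduct.map_comp, ← TensorProduct.map_comp]
    rw [LinearMap.comp_assoc (((J G i)).ρ gg⁻¹) f' (M.ρ gg),
      LinearMap.comp_assoc (((J G j)).ρ gg⁻¹) g' (N.ρ gg), hf', hg']
  exact key f.1 g.1 hf hg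

lemma conj_term {i j : ℤ} {M N : Rep ℤ G} (u : (J G i).V →ₗ[ℤ] M.V)
    (w : (J G j).V →ₗ[ℤ] N.V) (h : G) :
    (TensorProduct.map (M.ρ h ∘ₗ u ∘ₗ (J G i).ρ h⁻¹) (N.ρ h ∘ₗ w ∘ₗ (J G j).ρ h⁻¹)).comp
        (μ G i j).hom.toLinearMap
      = ((hRep (J G (i + j)) (M ⊗ N)).ρ h) ((TensorProduct.map u w).comp (μ G i j).hom.toLinearMap) := by
  have hμ : (μ G i j).hom.toLinearMap ∘ₗ (J G (i + j)).ρ h⁻¹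
      = TensorProduct.map ((J G i).ρ h⁻¹) ((J G j).ρ h⁻¹) ∘ₗ (μ G i j).hom.toLinearMap := by
    have hc := (μ G i j).hom.isIntertwining' h⁻¹
    exact hc
  show _ = (M ⊗ N).ρ h ∘ₗ ((TensorProduct.map u w).comp (μ G i j).hom.toLinearMap) ∘ₗ (J G (i + j)).ρ h⁻¹
  rw [LinearMap.comp_assoc, hμ, ← LinearMap.comp_assoc, ← LinearMap.comp_assoc]
  rw [TensorProduct.map_comp, TensorProduct.map_comp]
  rfl

section MapComp
variable {U V₁ V₂ W₁ W₂ : Type} [AddCommGroup U] [Module k U] [AddCommGroup V₁] [Module k V₁]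
  [AddCommGroup V₂] [Module k V₂] [AddCommGroup W₁] [Module k W₁] [AddCommGroup W₂] [Module k W₂]

lemma map_sum_left_comp {ι : Type} (s : Finset ι) (F : ι → V₁ →ₗ[k] W₁) (g : V₂ →ₗ[k] W₂)
    (m : U →ₗ[k] V₁ ⊗[k] V₂) :
    (TensorProduct.map (∑ h ∈ s, F h) g).comp m = ∑ h ∈ s, (TensorProduct.map (F h) g).comp m :=
  map_sum (LinearMap.lcomp k (W₁ ⊗[k] W₂) m ∘ₗ
    (TensorProduct.mapBilinear (RingHom.id k) V₁ V₂ W₁ W₂).flip g) F s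

lemma map_sum_right_comp {ι : Type} (s : Finset ι) (f : V₁ →ₗ[k] W₁) (F : ι → V₂ →ₗ[k] W₂)
    (m : U →ₗ[k] V₁ ⊗[k] V₂) :
    (TensorProduct.map f (∑ h ∈ s, F h)).comp m = ∑ h ∈ s, (TensorProduct.map f (F h)).comp m :=
  map_sum (LinearMap.lcomp k (W₁ ⊗[k] W₂) m ∘ₗ
    TensorProduct.mapBilinear (RingHom.id k) V₁ V₂ W₁ W₂ f) F s

lemma map_sub_left_comp (f f' : V₁ →ₗ[k] W₁) (g : V₂ →ₗ[k] W₂) (m : U →ₗ[k] V₁ ⊗[k] V₂) :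
    (TensorProduct.map (f - f') g).comp m
      = (TensorProduct.map f g).comp m - (TensorProduct.map f' g).comp m :=
  map_sub (LinearMap.lcomp k (W₁ ⊗[k] W₂) m ∘ₗ
    (TensorProduct.mapBilinear (RingHom.id k) V₁ V₂ W₁ W₂).flip g) f f'

lemma map_sub_right_comp (f : V₁ →ₗ[k] W₁) (g g' : V₂ →ₗ[k] W₂) (m : U →ₗ[k] V₁ ⊗[k] V₂) :
    (TensorProduct.map f (g - g')).comp m
      = (TensorProduct.map f g).comp m - (TensorProduct.map f g').comp m :=
  map_sub (LinearMap.lcomp k (W₁ ⊗[k] W₂) m ∘ₗ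
    TensorProduct.mapBilinear (RingHom.id k) V₁ V₂ W₁ W₂ f) g g'

end MapComp

lemma cup_norm_left {i j : ℤ} {M N : Rep ℤ G} (u : (J G i).V →ₗ[ℤ] M.V)
    (g : ((hRep (J G j) N).ρ.invariants)) :
    (TensorProduct.map (rnorm ((hRep (J G i) M).ρ) u) g.1).comp (μ G i j).hom.toLinearMap
      = rnorm ((hRep (J G (i + j)) (M ⊗ N)).ρ)
          ((TensorProduct.map u g.1).comp (μ G i j).hom.toLinearMap) := by
  have h1 : rnorm ((hRep (J G i) M).ρ) u = ∑ h : G, ((hRep (J G i) M).ρ h) u := by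
    exact LinearMap.sum_apply _ _ _
  have h2 : rnorm ((hRep (J G (i + j)) (M ⊗ N)).ρ) ((TensorProduct.map u g.1).comp (μ G i j).hom.toLinearMap)
      = ∑ h : G, ((hRep (J G (i + j)) (M ⊗ N)).ρ h)
          ((TensorProduct.map u g.1).comp (μ G i j).hom.toLinearMap) := by
    exact LinearMap.sum_apply _ _ _
  refine (congrArg (fun a : (J G i).V →ₗ[ℤ] M.V =>
    (TensorProduct.map a g.1).comp (μ G i j).hom.toLinearMap) h1).trans (Eq.trans ?_ h2.symm)
  refine (map_sum_left_comp Finset.univ (fun h : G => ((hRep (J G i) M).ρ h) u) g.1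
    (μ G i j).hom.toLinearMap).trans ?_
  refine Finset.sum_congr rfl fun h _ => ?_
  have hginv : N.ρ h ∘ₗ g.1 ∘ₗ (J G j).ρ h⁻¹ = g.1 := g.2 h
  refine Eq.trans ?_ (conj_term u g.1 h)
  exact congrArg (fun a : (J G j).V →ₗ[ℤ] N.V =>
    (TensorProduct.map (M.ρ h ∘ₗ u ∘ₗ (J G i).ρ h⁻¹) a).comp (μ G i j).hom.toLinearMap) hginv.symm

lemma cup_norm_right {i j : ℤ} {M N : Rep ℤ G}
    (f : ((hRep (J G i) M).ρ.invariants)) (w : (J G j).V →ₗ[ℤ] N.V) :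
    (TensorProduct.map f.1 (rnorm ((hRep (J G j) N).ρ) w)).comp (μ G i j).hom.toLinearMap
      = rnorm ((hRep (J G (i + j)) (M ⊗ N)).ρ)
          ((TensorProduct.map f.1 w).comp (μ G i j).hom.toLinearMap) := by
  have h1 : rnorm ((hRep (J G j) N).ρ) w = ∑ h : G, ((hRep (J G j) N).ρ h) w := by
    exact LinearMap.sum_apply _ _ _
  have h2 : rnorm ((hRep (J G (i + j)) (M ⊗ N)).ρ) ((TensorProduct.map f.1 w).comp (μ G i j).hom.toLinearMap)
      = ∑ h : G, ((hRep (J G (i + j)) (M ⊗ N)).ρ h)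
          ((TensorProduct.map f.1 w).comp (μ G i j).hom.toLinearMap) := by
    exact LinearMap.sum_apply _ _ _
  refine (congrArg (fun a : (J G j).V →ₗ[ℤ] N.V =>
    (TensorProduct.map f.1 a).comp (μ G i j).hom.toLinearMap) h1).trans (Eq.trans ?_ h2.symm)
  refine (map_sum_right_comp Finset.univ f.1 (fun h : G => ((hRep (J G j) N).ρ h) w)
    (μ G i j).hom.toLinearMap).trans ?_
  refine Finset.sum_congr rfl fun h _ => ?_
  have hfinv : M.ρ h ∘ₗ f.1 ∘ₗ (J G i).ρ h⁻¹ = f.1 := f.2 h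
  refine Eq.trans ?_ (conj_term f.1 w h)
  exact congrArg (fun a : (J G i).V →ₗ[ℤ] M.V =>
    (TensorProduct.map a (N.ρ h ∘ₗ w ∘ₗ (J G j).ρ h⁻¹)).comp (μ G i j).hom.toLinearMap) hfinv.symm

lemma cup_welldef {i j : ℤ} {M N : Rep ℤ G}
    (a₁ : ((hRep (J G i) M).ρ.invariants)) (b₁ : ((hRep (J G j) N).ρ.invariants))
    (a₂ : ((hRep (J G i) M).ρ.invariants)) (b₂ : ((hRep (J G j) N).ρ.invariants))
    (ha : a₁ - a₂ ∈ rnormIm ((hRep (J G i) M).ρ))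
    (hb : b₁ - b₂ ∈ rnormIm ((hRep (J G j) N).ρ)) :
    tate0mk (ρ := (hRep (J G (i + j)) (M ⊗ N)).ρ) ((TensorProduct.map a₁.1 b₁.1).comp ((μ G i j).hom.toLinearMap)) (cup_invariance a₁ b₁)
      = tate0mk (ρ := (hRep (J G (i + j)) (M ⊗ N)).ρ) ((TensorProduct.map a₂.1 b₂.1).comp ((μ G i j).hom.toLinearMap)) (cup_invariance a₂ b₂) := by
  obtain ⟨u, hu⟩ := ha
  obtain ⟨w, hw⟩ := hb
  have hu' : rnorm ((hRep (J G i) M).ρ) u = a₁.1 - a₂.1 := congrArg Subtype.val hu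
  have hw' : rnorm ((hRep (J G j) N).ρ) w = b₁.1 - b₂.1 := congrArg Subtype.val hw
  have step1 : tate0mk (ρ := (hRep (J G (i + j)) (M ⊗ N)).ρ) ((TensorProduct.map a₁.1 b₁.1).comp ((μ G i j).hom.toLinearMap))
        (cup_invariance a₁ b₁)
      = tate0mk (ρ := (hRep (J G (i + j)) (M ⊗ N)).ρ) ((TensorProduct.map a₂.1 b₁.1).comp ((μ G i j).hom.toLinearMap)) (cup_invariance a₂ b₁) := by
    refine (Submodule.Quotient.eq _).mpr ?_
    refine ⟨(TensorProduct.map u b₁.1).comp ((μ G i j).hom.toLinearMap), ?_⟩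
    apply Subtype.ext
    have key := cup_norm_left u b₁
    refine key.symm.trans ?_
    refine (congrArg (fun a : (J G i).V →ₗ[ℤ] M.V =>
      (TensorProduct.map a b₁.1).comp (μ G i j).hom.toLinearMap) hu').trans ?_
    exact map_sub_left_comp a₁.1 a₂.1 b₁.1 (μ G i j).hom.toLinearMap
  have step2 : tate0mk (ρ := (hRep (J G (i + j)) (M ⊗ N)).ρ) ((TensorProduct.map a₂.1 b₁.1).comp ((μ G i j).hom.toLinearMap))
        (cup_invariance a₂ b₁)
      = tate0mk (ρ := (hRep (J G (i + j)) (M ⊗ N)).ρ) ((TensorProduct.map a₂.1 b₂.1).comp ((μ G i j).hom.toLinearMap)) (cup_invariance a₂ b₂) := by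
    refine (Submodule.Quotient.eq _).mpr ?_
    refine ⟨(TensorProduct.map a₂.1 w).comp ((μ G i j).hom.toLinearMap), ?_⟩
    apply Subtype.ext
    have key := cup_norm_right a₂ w
    refine key.symm.trans ?_
    refine (congrArg (fun a : (J G j).V →ₗ[ℤ] N.V =>
      (TensorProduct.map a₂.1 a).comp (μ G i j).hom.toLinearMap) hw').trans ?_
    exact map_sub_right_comp a₂.1 b₁.1 b₂.1 (μ G i j).hom.toLinearMap
  exact step1.trans step2

/-- The cup product `Ĥ^i(G, M) × Ĥ^j(G, N) → Ĥ^{i+j}(G, M ⊗ N)` on Tate cohomology,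
induced by the comparison maps `μ`. -/
noncomputable def cup {i j : ℤ} {M N : Rep ℤ G} (z₁ : tate i M) (z₂ : tate j N) :
    tate (i + j) (M ⊗ N) :=
  Quotient.liftOn₂ z₁ z₂
    (fun f g => tate0mk ((TensorProduct.map f.1 g.1).comp ((μ G i j).hom.toLinearMap)) (cup_invariance f g))
    (fun a₁ b₁ a₂ b₂ ha hb => cup_welldef a₁ b₁ a₂ b₂
      ((Submodule.quotientRel_def _).mp ha) ((Submodule.quotientRel_def _).mp hb))

/-! ### Pairings -/

/-- The composition pairing `Hom_ℤ(B, C) ⊗ Hom_ℤ(A, B) ⟶ Hom_ℤ(A, C)`, `f ⊗ φ ↦ f ∘ φ`. -/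
noncomputable def compPair (A B C : Rep ℤ G) : hRep B C ⊗ hRep A B ⟶ hRep A C :=
  MonoidalClosed.curry <|
    (A ◁ (β_ (hRep B C) (hRep A B)).hom) ≫ (α_ A (hRep A B) (hRep B C)).inv
      ≫ (((ihom.ev A).app B) ▷ hRep B C) ≫ (ihom.ev B).app C

/-- The evaluation pairing `Hom_ℤ(X, B) ⊗ X ⟶ B`, `f ⊗ x ↦ f x`. -/
noncomputable def evPair (X B : Rep ℤ G) : hRep X B ⊗ X ⟶ B :=
  (β_ (hRep X B) X).hom ≫ (ihom.ev X).app B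

/-- The cup product `Ĥ^i(G, Hom(X, A)) × Ĥ^j(G, Hom(X', X)) → Ĥ^{i+j}(G, Hom(X', A))`
induced by the composition pairing. -/
noncomputable def ccup {i j : ℤ} {X X' A : Rep ℤ G}
    (z : tate i (hRep X A)) (x : tate j (hRep X' X)) : tate (i + j) (hRep X' A) :=
  tmap (i + j) (compPair X' X A) (cup z x)

/-- `ccup`, with the degree of the target adjusted along an equality of integers. -/
noncomputable def ccupTo {i j m : ℤ} {X X' A : Rep ℤ G}
    (z : tate i (hRep X A)) (x : tate j (hRep X' X)) (h : i + j = m) :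
    tate m (hRep X' A) :=
  tcast h (ccup z x)

/-- The class of the identity in `Ĥ⁰(G, Hom_ℤ(X, X))`. -/
noncomputable def idCls (X : Rep ℤ G) : tate 0 (hRep X X) :=
  mkCls (MonoidalClosed.curry (ρ_ X).hom)

/-! ### Encoding pairs and related notions -/

/-- `(X, X')` is an *`r`-encoding pair* if for some `i ∈ ℤ` there is a natural isomorphism
of functors `Ĥ^i(G, Hom_ℤ(X, -)) ≅ Ĥ^{i+r}(G, Hom_ℤ(X', -))` on `Rep ℤ G`. -/
def IsEncodingPair {G : Type} [Group G] [Fintype G] (r : ℤ) (X X' : Rep ℤ G) : Prop :=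
  ∃ (i : ℤ) (e : ∀ A : Rep ℤ G, tate i (hRep X A) ≃+ tate (i + r) (hRep X' A)),
    ∀ {A B : Rep ℤ G} (φ : A ⟶ B) (z : tate i (hRep X A)),
      e B (tmap i ((Rep.ihom X).map φ) z) = tmap (i + r) ((Rep.ihom X').map φ) (e A z)

/-- `x ∈ Ĥ^r(G, Hom_ℤ(X', X))` is an *encoding element* for the pair `(X, X')` if it has a
*decoding element* `x' ∈ Ĥ^{-r}(G, Hom_ℤ(X, X'))` with `x' ∪ x = [id_{X'}]` and
`x ∪ x' = [id_X]`. -/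
def IsEncodingElement {G : Type} [Group G] [Fintype G] {r : ℤ} (X X' : Rep ℤ G)
    (x : tate r (hRep X' X)) : Prop :=
  ∃ x' : tate (-r) (hRep X X'),
    ccupTo x' x (by ring) = idCls X' ∧ ccupTo x x' (by ring) = idCls X

/-- The induced `G`-module `ℤ[G] ⊗_ℤ A ≅ (G →₀ A)`, with `G` acting by left translation. -/
noncomputable def indRep (G : Type) [Group G] (A : Type) [AddCommGroup A] [Module ℤ A] :
    Rep ℤ G :=
  Rep.of (G := G) (X := G →₀ A)
    { toFun := fun g => Finsupp.lmapDomain A ℤ (fun h => g * h)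
      map_one' := by
        ext x h
        simp [Finsupp.lmapDomain_apply, Finsupp.mapDomain_id, one_mul]
      map_mul' := fun g g' => by
        ext x h
        simp [Finsupp.lmapDomain_apply, Module.End.mul_apply, Finsupp.mapDomain_single,
          mul_assoc] }

/-- A `G`-module is *induced* if it is isomorphic to `ℤ[G] ⊗_ℤ A` for some abelian group `A`. -/
def IsInduced {G : Type} [Group G] (M : Rep ℤ G) : Prop :=
  ∃ (A : Type) (_ : AddCommGroup A) (_ : Module ℤ A), Nonempty (M ≅ indRep G A)

/-- A class `φ ∈ Ĥ⁰(G, Hom_ℤ(X, X))` is a unit for the (composition) cup product. -/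
def IsUnitCls {G : Type} [Group G] [Fintype G] {X : Rep ℤ G}
    (φ : tate 0 (hRep X X)) : Prop :=
  ∃ ψ : tate 0 (hRep X X),
    ccupTo φ ψ (by ring) = idCls X ∧ ccupTo ψ φ (by ring) = idCls X


/-- The natural map `Hom_ℤ(X, A) ⊗ I_G ⟶ Hom_ℤ(X, A ⊗ I_G)`, `f ⊗ z ↦ (x ↦ f x ⊗ z)`. -/
noncomputable def pr0 (X A : Rep ℤ G) : hRep X A ⊗ IGrep G ⟶ hRep X (A ⊗ IGrep G) :=
  MonoidalClosed.curry ((α_ X (hRep X A) (IGrep G)).inv ≫ ((ihom.ev X).app A ▷ IGrep G))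

/-- The natural evaluation map `Hom_ℤ(X, Hom_ℤ(I_G, A)) ⊗ I_G ⟶ Hom_ℤ(X, A)`,
`f ⊗ z ↦ (x ↦ f x z)`. -/
noncomputable def pr1 (X A : Rep ℤ G) :
    hRep X (hRep (IGrep G) A) ⊗ IGrep G ⟶ hRep X A :=
  MonoidalClosed.curry ((α_ X (hRep X (hRep (IGrep G) A)) (IGrep G)).inv
    ≫ ((ihom.ev X).app (hRep (IGrep G) A) ▷ IGrep G) ≫ evPair (IGrep G) A)

/-- The natural evaluation map `Hom_ℤ(X', X) ⊗ (X' ⊗ A) ⟶ X ⊗ A`. -/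
noncomputable def tPair (X' X A : Rep ℤ G) : hRep X' X ⊗ (X' ⊗ A) ⟶ X ⊗ A :=
  (α_ (hRep X' X) X' A).inv ≫ (evPair X' X ▷ A)

/-- A functor `Rep ℤ G ⥤ Rep ℤ G` sends `ℤ`-split short exact sequences of `G`-modules to
short exact sequences of `G`-modules. -/
def PreservesZSplitSES {G : Type} [Group G] (F : Rep.{0} ℤ G ⥤ Rep.{0} ℤ G) : Prop :=
  ∀ (A B C : Rep ℤ G) (f : A ⟶ B) (g : B ⟶ C),
    Function.Injective f.hom → Function.Surjective g.hom → Function.Exact f.hom g.hom →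
    (∃ s : C.V →+ B.V, ∀ x, g.hom (s x) = x) →
    Function.Injective (F.map f).hom ∧ Function.Surjective (F.map g).hom ∧
      Function.Exact (F.map f).hom (F.map g).hom

/-- A *shiftable functor*: it sends `ℤ`-split short exact sequences of `G`-modules to short
exact sequences, and sends induced modules to induced modules. -/
def Shiftable {G : Type} [Group G] (F : Rep ℤ G ⥤ Rep ℤ G) : Prop :=
  PreservesZSplitSES F ∧ ∀ M : Rep ℤ G, IsInduced M → IsInduced (F.obj M)

end Enc

namespace Enc
variable {G : Type} [Group G] [Fintype G]

lemma tate0map_mk {V V₂ : Type} [AddCommGroup V] [Module ℤ V] [AddCommGroup V₂] [Module ℤ V₂]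
    {ρ : Representation ℤ G V} {σ : Representation ℤ G V₂}
    (f : V →ₗ[ℤ] V₂) (hf : ∀ (g : G) (v : V), f (ρ g v) = σ g (f v)) (v : V)
    (hv : v ∈ ρ.invariants) :
    tate0map f hf (tate0mk v hv) = tate0mk (f v) (invariants_comp f hf v hv) := rfl

lemma tate0mk_surj {V : Type} [AddCommGroup V] [Module ℤ V] 
    {ρ : Representation ℤ G V} (z : tate0 ρ) : ∃ v hv, z = tate0mk v hv := by
  obtain ⟨⟨v, hv⟩, rfl⟩ := Submodule.Quotient.mk_surjective _ z
  exact ⟨v, hv, rfl⟩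

lemma tate0mk_eq_iff {V : Type} [AddCommGroup V] [Module ℤ V] 
    {ρ : Representation ℤ G V} (v w : V) (hv : v ∈ ρ.invariants) (hw : w ∈ ρ.invariants) :
    tate0mk v hv = tate0mk w hw ↔ ∃ y, rnorm ρ y = v - w := by
  refine (Submodule.Quotient.eq (rnormIm ρ)).trans ?_
  constructor
  · rintro ⟨y, hy⟩
    exact ⟨y, congrArg Subtype.val hy⟩
  · rintro ⟨y, hy⟩
    exact ⟨y, Subtype.ext hy⟩

lemma rnorm_comm {V V₂ : Type} [AddCommGroup V] [Module ℤ V] [AddCommGroup V₂] [Module ℤ V₂]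
    {ρ : Representation ℤ G V} {σ : Representation ℤ G V₂}
    (f : V →ₗ[ℤ] V₂) (hf : ∀ (g : G) (v : V), f (ρ g v) = σ g (f v)) (v : V) :
    rnorm σ (f v) = f (rnorm ρ v) := by
  simp only [rnorm, LinearMap.sum_apply, map_sum]
  exact Finset.sum_congr rfl fun g _ => (hf g v).symm

lemma tate0map_bij {V V₂ : Type} [AddCommGroup V] [Module ℤ V] [AddCommGroup V₂] [Module ℤ V₂]
    {ρ : Representation ℤ G V} {σ : Representation ℤ G V₂}
    (f : V →ₗ[ℤ] V₂) (hf : ∀ (g : G) (v : V), f (ρ g v) = σ g (f v))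
    (hb : Function.Bijective f) : Function.Bijective (tate0map f hf) := by
  constructor
  · intro a b hab
    obtain ⟨v, hv, rfl⟩ := tate0mk_surj a
    obtain ⟨w, hw, rfl⟩ := tate0mk_surj b
    rw [tate0map_mk, tate0map_mk, tate0mk_eq_iff] at hab
    obtain ⟨y, hy⟩ := hab
    obtain ⟨y, rfl⟩ := hb.2 y
    rw [tate0mk_eq_iff]
    refine ⟨y, hb.1 ?_⟩
    rw [← rnorm_comm f hf, hy, map_sub]
  · intro b
    obtain ⟨w, hw, rfl⟩ := tate0mk_surj b
    obtain ⟨v, rfl⟩ := hb.2 w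
    refine ⟨tate0mk v ?_, tate0map_mk _ _ _ _⟩
    intro g
    apply hb.1
    rw [hf]
    exact hw g

/-- View an element of the internal hom as a linear map. -/
def hL {P M : Rep.{0} ℤ G} (f : (hRep P M).V) : P.V →ₗ[ℤ] M.V := f

/-- View a linear map as an element of the internal hom. -/
def uL {P M : Rep.{0} ℤ G} (f : P.V →ₗ[ℤ] M.V) : (hRep P M).V := f

/-- Precomposition with a morphism. -/
noncomputable def preL {P R : Rep.{0} ℤ G} (s : P ⟶ R) (M : Rep.{0} ℤ G) :
    (hRep R M).V →ₗ[ℤ] (hRep P M).V where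
  toFun f := (hL f).comp s.hom.toLinearMap
  map_add' _ _ := rfl
  map_smul' _ _ := rfl

lemma preL_comm {P R : Rep.{0} ℤ G} (s : P ⟶ R) (M : Rep.{0} ℤ G) (g : G) (v : (hRep R M).V) :
    preL s M ((hRep R M).ρ g v) = (hRep P M).ρ g (preL s M v) := by
  refine LinearMap.ext fun x => ?_
  show M.ρ g (hL v (R.ρ g⁻¹ (s.hom x))) = M.ρ g (hL v (s.hom (P.ρ g⁻¹ x)))
  rw [Rep.hom_comm_apply]

/-- `s` induces isomorphisms on Tate cohomology. -/
def PreBij {P R : Rep.{0} ℤ G} (s : P ⟶ R) : Prop :=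
  ∀ M : Rep.{0} ℤ G, Function.Bijective (tate0map (preL s M) (preL_comm s M))

lemma PreBij.comp {P R S : Rep.{0} ℤ G} {s : P ⟶ R} {t : R ⟶ S} (hs : PreBij s) (ht : PreBij t) :
    PreBij (s ≫ t) := by
  intro M
  have : (tate0map (preL (s ≫ t) M) (preL_comm (s ≫ t) M) : _ → _) =
      tate0map (preL s M) (preL_comm s M) ∘ tate0map (preL t M) (preL_comm t M) := by
    funext z
    obtain ⟨v, hv, rfl⟩ := tate0mk_surj z
    rfl
  rw [this]
  exact (hs M).comp (ht M)

lemma PreBij.of_isIso {P R : Rep.{0} ℤ G} (s : P ⟶ R) [IsIso s] : PreBij s := by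
  intro M
  apply tate0map_bij
  have h1 : ∀ x, (inv s).hom (s.hom x) = x := fun x => by
    rw [← Rep.comp_apply, IsIso.hom_inv_id]; rfl
  have h2 : ∀ x, s.hom ((inv s).hom x) = x := fun x => by
    rw [← Rep.comp_apply, IsIso.inv_hom_id]; rfl
  refine Function.bijective_iff_has_inverse.mpr ⟨preL (inv s) M, fun f => ?_, fun f => ?_⟩
  · refine LinearMap.ext fun x => ?_
    show hL f (s.hom ((inv s).hom x)) = hL f x
    rw [h2]
  · refine LinearMap.ext fun x => ?_
    show hL f ((inv s).hom (s.hom x)) = hL f x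
    rw [h1]

/-- stable equivalence -/
lemma PreBij.of_stable {P R : Rep.{0} ℤ G} (s : P ⟶ R) (r : R ⟶ P)
    (u : P.V →ₗ[ℤ] P.V) (v : R.V →ₗ[ℤ] R.V)
    (hu : ∀ x, ∑ g : G, P.ρ g (u (P.ρ g⁻¹ x)) = r.hom (s.hom x) - x)
    (hv : ∀ x, ∑ g : G, R.ρ g (v (R.ρ g⁻¹ x)) = s.hom (r.hom x) - x) : PreBij s := by
  have key : ∀ (Q M : Rep.{0} ℤ G) (f : (hRep Q M).V) (_ : f ∈ (hRep Q M).ρ.invariants)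
      (w : Q.V →ₗ[ℤ] Q.V) (x : Q.V),
      hL (rnorm (hRep Q M).ρ (uL ((hL f).comp w))) x
       = hL f (∑ g : G, Q.ρ g (w (Q.ρ g⁻¹ x))) := by
    intro Q M f hf w x
    have hf' : ∀ (g : G) (y : Q.V), hL f (Q.ρ g y) = M.ρ g (hL f y) := by
      intro g y
      have := LinearMap.congr_fun (hf g) (Q.ρ g y)
      refine this.symm.trans ?_
      show M.ρ g (hL f (Q.ρ g⁻¹ (Q.ρ g y))) = _
      rw [Representation.inv_self_apply]
    rw [map_sum]
    refine (congrArg (fun F => hL F x) (LinearMap.sum_apply _ _ _)).trans ?_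
    refine (LinearMap.sum_apply _ _ _).trans ?_
    refine Finset.sum_congr rfl fun g _ => ?_
    rw [hf']
    rfl
  intro M
  constructor
  · intro a b hab
    obtain ⟨f, hf, rfl⟩ := tate0mk_surj a
    obtain ⟨f', hf', rfl⟩ := tate0mk_surj b
    rw [tate0map_mk, tate0map_mk, tate0mk_eq_iff] at hab
    obtain ⟨y, hy⟩ := hab
    rw [tate0mk_eq_iff]
    have hff : f - f' ∈ (hRep R M).ρ.invariants := Submodule.sub_mem _ hf hf'
    refine ⟨preL r M y - uL ((hL (f - f')).comp v), ?_⟩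
    rw [map_sub, rnorm_comm (preL r M) (preL_comm r M), hy]
    refine LinearMap.ext fun x => ?_
    have e1 := key R M (f - f') hff v x
    rw [hv, map_sub] at e1
    refine (congrArg₂ (· - ·) rfl e1).trans ?_
    show (hL f (s.hom (r.hom x)) - hL f' (s.hom (r.hom x))) - ((hL f (s.hom (r.hom x)) -
      hL f' (s.hom (r.hom x))) - (hL f x - hL f' x)) = hL f x - hL f' x
    abel
  · intro b
    obtain ⟨f, hf, rfl⟩ := tate0mk_surj b
    refine ⟨tate0mk (preL r M f) (invariants_comp _ (preL_comm r M) _ hf), ?_⟩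
    rw [tate0map_mk, tate0mk_eq_iff]
    refine ⟨uL ((hL f).comp u), ?_⟩
    refine LinearMap.ext fun x => ?_
    refine (key P M f hf u x).trans ?_
    rw [hu, map_sub]
    rfl
end Enc
namespace Enc
variable {G : Type} [Group G] [Fintype G]

/-- The element `h - 1` of the augmentation ideal. -/
noncomputable def bI (h : G) : IGcar G :=
  ⟨Finsupp.single h 1 - Finsupp.single 1 1, by simp [aug]⟩

/-- The coordinate functional at `h`. -/
noncomputable def dI (h : G) : IGcar G →ₗ[ℤ] ℤ :=
  (Finsupp.lapply h : (G →₀ ℤ) →ₗ[ℤ] ℤ) ∘ₗ (LinearMap.ker (aug G)).subtype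

lemma sum_dI (x : IGcar G) : ∑ h : G, dI h x = 0 := by
  have h : aug G x.1 = 0 := x.2
  unfold aug at h
  rw [Finsupp.linearCombination_apply, Finsupp.sum_fintype _ _ (by simp)] at h
  simpa [dI] using h

lemma sum_dI_bI (x : IGcar G) : ∑ h : G, dI h x • bI h = x := by
  have h0 := sum_dI x
  apply Subtype.ext
  have h1 : ((∑ h : G, dI h x • bI h : IGcar G) : G →₀ ℤ) =
      ∑ h : G, dI h x • (Finsupp.single h 1 - Finsupp.single 1 1 : G →₀ ℤ) := by
    rw [Submodule.coe_sum]; rfl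
  rw [h1]
  simp only [smul_sub, Finset.sum_sub_distrib, ← Finset.sum_smul, h0, zero_smul, sub_zero]
  ext k
  classical
  simp [dI]

lemma IG_rho_apply (g : G) (x : IGcar G) (h : G) : dI h (IGρ G g x) = dI (g⁻¹ * h) x := by
  show (Finsupp.mapDomain (g • ·) x.1) h = x.1 (g⁻¹ * h)
  have := Finsupp.mapDomain_apply (f := fun y : G => g • y) (MulAction.injective g) x.1 (g⁻¹ * h)
  simpa using this

lemma IG_rho_bI (g h : G) : IGρ G g (bI h) = bI (g * h) - bI g := by
  apply Subtype.ext
  show (Finsupp.lmapDomain ℤ ℤ (g • ·) (Finsupp.single h 1 - Finsupp.single 1 1 : G →₀ ℤ)) =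
    (Finsupp.single (g*h) 1 - Finsupp.single 1 1) - (Finsupp.single g 1 - Finsupp.single 1 1)
  rw [map_sub]
  simp [Finsupp.mapDomain_single]

lemma preElt_eq : preElt G = ∑ h : G, dI h ⊗ₜ[ℤ] bI h := by
  apply (dualTensorHomEquiv ℤ (IGcar G) (IGcar G)).injective
  refine ((dualTensorHomEquiv ℤ (IGcar G) (IGcar G)).apply_symm_apply LinearMap.id).trans ?_
  refine LinearMap.ext fun x => ?_
  show x = dualTensorHom ℤ _ _ (∑ h : G, dI h ⊗ₜ[ℤ] bI h) x
  rw [map_sum, LinearMap.sum_apply]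
  simp only [dualTensorHom_apply]
  exact (sum_dI_bI x).symm

/-- evaluation -/
noncomputable def evI : Module.Dual ℤ (IGcar G) ⊗[ℤ] IGcar G →ₗ[ℤ] ℤ := contractLeft ℤ (IGcar G)

lemma evI_preElt : evI (preElt G) = (Fintype.card G : ℤ) - 1 := by
  rw [preElt_eq, map_sum]
  simp only [evI, contractLeft_apply]
  classical
  have : ∀ h : G, dI h (bI h) = 1 - (if h = 1 then 1 else 0) := by
    intro h
    simp [dI, bI, Finsupp.single_apply, eq_comm]
  simp [this]

/-- homotopy -/
noncomputable def uI : Module.Dual ℤ (IGcar G) ⊗[ℤ] IGcar G →ₗ[ℤ] Module.Dual ℤ (IGcar G) ⊗[ℤ] IGcar G :=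
  ∑ h : G, (LinearMap.toSpanSingleton ℤ _ (dI h ⊗ₜ[ℤ] bI h)) ∘ₗ LinearMap.mul' ℤ ℤ ∘ₗ
    TensorProduct.map (Module.Dual.eval ℤ _ (bI h)) (dI 1)

lemma uI_tmul (d : Module.Dual ℤ (IGcar G)) (x : IGcar G) :
    uI (d ⊗ₜ x) = ∑ h : G, (d (bI h) * dI 1 x) • (dI h ⊗ₜ[ℤ] bI h) := by
  simp only [uI, LinearMap.sum_apply]
  rfl

lemma sum_identity (d : Module.Dual ℤ (IGcar G)) (x y : IGcar G) :
    ∑ g : G, ∑ k : G, (dI g x * dI k y * (d (bI k) - d (bI g))) • (bI k - bI g) =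
      - (d x • y + d y • x) := by
  have hd : ∀ z, d z = ∑ h : G, dI h z * d (bI h) := by
    intro z
    conv_lhs => rw [← sum_dI_bI z]
    rw [map_sum]; simp
  have e : ∀ g k : G, (dI g x * dI k y * (d (bI k) - d (bI g))) • (bI k - bI g) =
     (dI g x) • ((dI k y * d (bI k)) • bI k) - (dI k y * d (bI k)) • (dI g x • bI g)
      - (dI g x * d (bI g)) • (dI k y • bI k) + (dI k y) • ((dI g x * d (bI g)) • bI g) := by
    intro g k
    module
  simp only [e, Finset.sum_add_distrib, Finset.sum_sub_distrib, ← Finset.smul_sum, ← Finset.sum_smul,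
    sum_dI, sum_dI_bI, ← hd]
  simp
  abel

/-- dual action -/
noncomputable def rD (g : G) : Module.Dual ℤ (IGcar G) →ₗ[ℤ] Module.Dual ℤ (IGcar G) :=
  (DIG G).ρ g

lemma rD_apply (g : G) (d) (x : IGcar G) : rD g d x = d (IGρ G g⁻¹ x) := rfl

lemma uI_norm (t : Module.Dual ℤ (IGcar G) ⊗[ℤ] IGcar G) :
    ∑ g : G, TensorProduct.map (rD g) (IGρ G g) (uI (TensorProduct.map (rD g⁻¹) (IGρ G g⁻¹) t))
      = (- evI t) • preElt G - t := by
  induction t with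
  | zero => simp
  | add x y hx hy =>
    simp only [map_add, Finset.sum_add_distrib, hx, hy]
    module
  | tmul d x =>
    apply (dualTensorHomEquiv ℤ (IGcar G) (IGcar G)).injective
    refine LinearMap.ext fun y => ?_
    have h2 : dualTensorHom ℤ (IGcar G) (IGcar G) (preElt G) = LinearMap.id :=
      (dualTensorHomEquiv ℤ (IGcar G) (IGcar G)).apply_symm_apply LinearMap.id
    show dualTensorHom ℤ _ _ _ y = dualTensorHom ℤ _ _ _ y
    rw [map_sub, map_smul, h2, map_sum]
    simp only [TensorProduct.map_tmul, uI_tmul, map_sum, map_zsmul, LinearMap.sum_apply,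
      LinearMap.smul_apply, LinearMap.sub_apply, dualTensorHom_apply, LinearMap.id_apply]
    have : (-evI (d ⊗ₜ[ℤ] x)) • y - d y • x = -(d x • y + d y • x) := by
      have : evI (d ⊗ₜ[ℤ] x) = d x := rfl
      rw [this]; module
    rw [this, ← sum_identity]
    refine Finset.sum_congr rfl fun g _ => ?_
    refine Fintype.sum_equiv (Equiv.mulLeft g) _ _ fun h => ?_
    simp only [rD_apply, IG_rho_apply, inv_inv, Equiv.coe_mulLeft, IG_rho_bI, mul_one, map_sub]
    module
end Enc
namespace Enc
variable {G : Type} [Group G] [Fintype G]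

variable (G) in
/-- The coevaluation `ℤ ⟶ I_G^∨ ⊗ I_G`. -/
noncomputable def cI : 𝟙_ (Rep ℤ G) ⟶ DIG G ⊗ IGrep G := coev G ≫ (β_ (IGrep G) (DIG G)).hom

lemma cI_apply (z : ℤ) : (cI G).hom z = z • preElt G := by
  show (TensorProduct.comm ℤ (IGcar G) (Module.Dual ℤ (IGcar G)))
    (z • (TensorProduct.comm ℤ (Module.Dual ℤ (IGcar G)) (IGcar G)) (preElt G)) = _
  rw [map_zsmul]
  congr 1
  exact (TensorProduct.comm ℤ (IGcar G) (Module.Dual ℤ (IGcar G))).apply_symm_apply (preElt G)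

variable (G) in
/-- Minus the evaluation. -/
noncomputable def rI : DIG G ⊗ IGrep G ⟶ 𝟙_ (Rep ℤ G) := -(evPair (IGrep G) (𝟙_ (Rep ℤ G)))

lemma rI_apply (t : Module.Dual ℤ (IGcar G) ⊗[ℤ] IGcar G) : (rI G).hom t = - evI t := by
  have : (evPair (IGrep G) (𝟙_ (Rep ℤ G))).hom t = evI t := by
    induction t with
    | zero => exact (map_zero _).trans (map_zero _).symm
    | add x y hx hy =>
      exact (map_add _ x y).trans ((congrArg₂ (· + ·) hx hy).trans (map_add evI x y).symm)
    | tmul d x => rfl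
  exact congrArg Neg.neg this

section Gen
variable {k : Type} [CommRing k] {K T Z : Type} [AddCommGroup K] [Module k K]
  [AddCommGroup T] [Module k T] [AddCommGroup Z] [Module k Z]

lemma gen1 (c : Z →ₗ[k] T) (r : T →ₗ[k] Z) (n : ℕ) (h : ∀ z, r (c z) = z - n • z)
    (x : K ⊗[k] Z) : LinearMap.lTensor K r (LinearMap.lTensor K c x) = x - n • x := by
  induction x with
  | zero => simp
  | add x y hx hy => rw [map_add, map_add, hx, hy, smul_add]; abel
  | tmul a z =>
    rw [LinearMap.lTensor_tmul, LinearMap.lTensor_tmul, h, TensorProduct.tmul_sub]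
    congr 1
    exact map_nsmul (TensorProduct.mk k K Z a) n z

lemma gen2 (A A' : G → K →ₗ[k] K) (B B' : G → T →ₗ[k] T) (u : T →ₗ[k] T)
    (c : Z →ₗ[k] T) (r : T →ₗ[k] Z) (hA : ∀ g x, A g (A' g x) = x)
    (hu : ∀ t, ∑ g : G, B g (u (B' g t)) = c (r t) - t) (x : K ⊗[k] T) :
    ∑ g : G, TensorProduct.map (A g) (B g) (LinearMap.lTensor K u (TensorProduct.map (A' g) (B' g) x))
      = LinearMap.lTensor K c (LinearMap.lTensor K r x) - x := by
  induction x with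
  | zero => simp
  | add x y hx hy =>
    simp only [map_add, Finset.sum_add_distrib, hx, hy]
    abel
  | tmul a t =>
    simp only [TensorProduct.map_tmul, LinearMap.lTensor_tmul, hA]
    rw [← TensorProduct.tmul_sub, ← hu, TensorProduct.tmul_sum]

end Gen

lemma preBij_cI (K : Rep.{0} ℤ G) : PreBij (K ◁ cI G) := by
  refine PreBij.of_stable (K ◁ cI G) (K ◁ rI G) (-LinearMap.id) (LinearMap.lTensor K.V (uI (G := G))) ?_ ?_
  · intro x
    have h1 : ∀ g : G, (K ⊗ 𝟙_ (Rep ℤ G)).ρ g ((-LinearMap.id : (K ⊗ 𝟙_ (Rep ℤ G)).V →ₗ[ℤ] (K ⊗ 𝟙_ (Rep ℤ G)).V)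
        ((K ⊗ 𝟙_ (Rep ℤ G)).ρ g⁻¹ x)) = -x := by
      intro g
      rw [LinearMap.neg_apply, LinearMap.id_apply, map_neg, Representation.self_inv_apply]
    rw [Finset.sum_congr rfl fun g _ => h1 g]
    have h2 := gen1 (K := K.V) (cI G).hom.toLinearMap (rI G).hom.toLinearMap (Fintype.card G) (by
      intro z
      show (rI G).hom ((cI G).hom z) = z - (Fintype.card G) • z
      change ℤ at z
      rw [cI_apply, rI_apply, map_zsmul, evI_preElt]
      show -(z * ((Fintype.card G : ℤ) - 1)) = (z - (Fintype.card G) • z : ℤ)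
      rw [nsmul_eq_mul]
      ring) x
    refine Eq.trans ?_ (congrArg (· - x) h2).symm
    rw [Finset.sum_const, Finset.card_univ]
    show Fintype.card G • (-x) = x - (Fintype.card G) • x - x
    rw [smul_neg]
    abel
  · exact gen2 (fun g => K.ρ g) (fun g => K.ρ g⁻¹) (fun g => TensorProduct.map (rD g) (IGρ G g))
      (fun g => TensorProduct.map (rD g⁻¹) (IGρ G g⁻¹)) (uI (G := G))
      (cI G).hom.toLinearMap (rI G).hom.toLinearMap (fun g x => Representation.self_inv_apply _ _ _)
      (fun t => by
        refine (uI_norm t).trans ?_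
        rw [← rI_apply, ← cI_apply]
        rfl)

lemma preBij_sMap (i : ℤ) : PreBij (sMap (G := G) i) := by
  match i with
  | .ofNat m => exact PreBij.of_isIso (𝟙 (Jp G m ⊗ IGrep G))
  | .negSucc 0 =>
    have : (sMap (G := G) (.negSucc 0)) = (λ_ (𝟙_ (Rep ℤ G))).inv ≫ (𝟙_ (Rep ℤ G) ◁ cI G) ≫
        (α_ (𝟙_ (Rep ℤ G)) (DIG G) (IGrep G)).inv := by
      show coev G ≫ (β_ (IGrep G) (DIG G)).hom ≫ ((λ_ (DIG G)).inv ▷ IGrep G) = _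
      rw [← leftUnitor_inv_naturality_assoc, cI]
      simp
    rw [this]
    exact PreBij.comp (PreBij.of_isIso (λ_ (𝟙_ (Rep ℤ G))).inv) ((preBij_cI _).comp
      (PreBij.of_isIso (α_ (𝟙_ (Rep ℤ G)) (DIG G) (IGrep G)).inv))
  | .negSucc (m+1) =>
    exact PreBij.comp (PreBij.of_isIso (ρ_ (Jn G (m+1))).inv) ((preBij_cI _).comp
      (PreBij.of_isIso (α_ (Jn G (m+1)) (DIG G) (IGrep G)).inv))

lemma preBij_mu (i : ℤ) : PreBij (μ G i 1) := by
  have : IsIso (μpos (G := G) i 0) := by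
    have h : IsIso (eqToHom (congrArg (J G) (show i + ((0 : ℕ) : ℤ) = i by omega)) ≫ (ρ_ (J G i)).inv) :=
      inferInstance
    exact h
  show PreBij (μpos (G := G) i 1)
  exact PreBij.comp (PreBij.of_isIso _) (PreBij.comp (preBij_sMap _) (PreBij.comp
    (PreBij.of_isIso (μpos (G := G) i 0 ▷ IGrep G)) (PreBij.of_isIso (α_ _ _ _).hom)))
end Enc
namespace Enc
variable {G : Type} [Group G] [Fintype G]

lemma gen3 {k : Type} [CommRing k] {Q X I A : Type} [AddCommGroup Q] [Module k Q]
    [AddCommGroup X] [Module k X] [AddCommGroup I] [Module k I] [AddCommGroup A] [Module k A]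
    (h : Q ⊗[k] (k ⊗[k] I) →ₗ[k] X →ₗ[k] A) :
    ∃ f : Q →ₗ[k] X →ₗ[k] I →ₗ[k] A, ∀ q y x, f q y x = h (q ⊗ₜ (1 ⊗ₜ x)) y :=
  ⟨{ toFun := fun q => ((TensorProduct.curry h q) ∘ₗ (TensorProduct.mk k k I 1)).flip
     map_add' := fun a b => by ext; simp
     map_smul' := fun a b => by ext; simp }, fun q y x => rfl⟩

/-- The map `f ↦ (q ⊗ (1 ⊗ z) ↦ (x ↦ f q x z))`. -/
noncomputable def FL (Q X A : Rep.{0} ℤ G) :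
    (hRep Q (hRep X (hRep (IGrep G) A))).V →ₗ[ℤ]
      (hRep (Q ⊗ (𝟙_ (Rep ℤ G) ⊗ IGrep G)) (hRep X A)).V where
  toFun f := uL ((pr1 X A).hom.toLinearMap ∘ₗ
    TensorProduct.map (hL f) (λ_ (IGrep G)).hom.hom.toLinearMap)
  map_add' f f' := by
    refine (congrArg (fun t => (pr1 X A).hom.toLinearMap ∘ₗ t)
      (TensorProduct.map_add_left (hL f) (hL f') (λ_ (IGrep G)).hom.hom.toLinearMap)).trans ?_
    exact LinearMap.comp_add _ _ _
  map_smul' a f := by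
    refine (congrArg (fun t => (pr1 X A).hom.toLinearMap ∘ₗ t)
      (TensorProduct.map_smul_left a (hL f) (λ_ (IGrep G)).hom.hom.toLinearMap)).trans ?_
    exact LinearMap.ext fun t => (pr1 X A).hom.toLinearMap.map_smul' a _

lemma FL_tmul (Q X A : Rep.{0} ℤ G) (f) (q : Q.V) (x : IGcar G) (a : ℤ) (y : X.V) :
    hL (hL (FL Q X A f) (q ⊗ₜ[ℤ] (a ⊗ₜ[ℤ] x))) y = hL (hL (hL f q) y) (a • x) := rfl

lemma hom_ext3 {Q X A : Rep.{0} ℤ G} (f f' : (hRep (Q ⊗ (𝟙_ (Rep ℤ G) ⊗ IGrep G)) (hRep X A)).V)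
    (h : ∀ (q : Q.V) (a : ℤ) (x : IGcar G) (y : X.V),
      hL (hL f (q ⊗ₜ[ℤ] (a ⊗ₜ[ℤ] x))) y = hL (hL f' (q ⊗ₜ[ℤ] (a ⊗ₜ[ℤ] x))) y) : f = f' := by
  refine TensorProduct.ext' fun q t => ?_
  refine LinearMap.congr_fun (f := (hL f).comp (TensorProduct.mk ℤ Q.V (𝟙_ (Rep ℤ G) ⊗ IGrep G).V q))
    (g := (hL f').comp (TensorProduct.mk ℤ Q.V (𝟙_ (Rep ℤ G) ⊗ IGrep G).V q)) ?_ t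
  refine TensorProduct.ext' fun a x => ?_
  exact LinearMap.ext fun y => h q a x y

lemma FL_comm (Q X A : Rep.{0} ℤ G) (g : G) (f) :
    FL Q X A ((hRep Q (hRep X (hRep (IGrep G) A))).ρ g f) = 
      (hRep (Q ⊗ (𝟙_ (Rep ℤ G) ⊗ IGrep G)) (hRep X A)).ρ g (FL Q X A f) := by
  refine hom_ext3 _ _ fun q a x y => ?_
  show A.ρ g (hL (hL (hL f (Q.ρ g⁻¹ q)) (X.ρ g⁻¹ y)) (IGρ G g⁻¹ (a • x))) =
    A.ρ g (hL (hL (hL f (Q.ρ g⁻¹ q)) (X.ρ g⁻¹ y)) (a • IGρ G g⁻¹ x))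
  rw [map_zsmul]

lemma FL_bij (Q X A : Rep.{0} ℤ G) : Function.Bijective (FL Q X A) := by
  constructor
  · intro f f' h
    refine LinearMap.ext fun q => LinearMap.ext fun y => LinearMap.ext fun x => ?_
    have e : hL (hL (hL f q) y) ((1 : ℤ) • (x : IGcar G)) =
        hL (hL (hL f' q) y) ((1 : ℤ) • (x : IGcar G)) :=
      congrArg (fun F => hL (hL F (q ⊗ₜ[ℤ] ((1 : ℤ) ⊗ₜ[ℤ] x))) y) h
    have ox : (1 : ℤ) • (x : IGcar G) = x := one_zsmul _
    rw [ox] at e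
    exact e
  · intro h
    obtain ⟨f, hf⟩ := gen3 (Q := Q.V) (X := X.V) (I := IGcar G) (A := A.V) h
    refine ⟨f, hom_ext3 _ _ fun q a x y => ?_⟩
    refine (hf q y (a • x)).trans ?_
    have : (1 : ℤ) ⊗ₜ[ℤ] (a • x) = a ⊗ₜ[ℤ] x := by
      rw [← TensorProduct.smul_tmul]; simp
    exact congrArg (fun t => hL (hL h (q ⊗ₜ[ℤ] t)) y) this

variable (G) in
/-- The fundamental class. -/
noncomputable def fcls : tate 1 (IGrep G) :=
  mkCls (n := 1) (show J G 1 ⟶ IGrep G from (λ_ (IGrep G)).hom)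

lemma cup_fcls (X A : Rep.{0} ℤ G) (i : ℤ) (z : tate i (hRep X (hRep (IGrep G) A))) :
    tmap (i + 1) (pr1 X A) (cup z (fcls G)) =
      tate0map (preL (μ G i 1) (hRep X A)) (preL_comm _ _) (tate0map (FL (J G i) X A) (FL_comm _ _ _) z) := by
  obtain ⟨f, hf, rfl⟩ := tate0mk_surj z
  rfl

lemma fcls_bij (X A : Rep.{0} ℤ G) (i : ℤ) : Function.Bijective
    (fun z : tate i (hRep X (hRep (IGrep G) A)) => tmap (i + 1) (pr1 X A) (cup z (fcls G))) := by
  simp only [cup_fcls]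
  exact (preBij_mu i (hRep X A)).comp (tate0map_bij _ (FL_comm (J G i) X A) (FL_bij _ _ _))

lemma fcls_nat (X : Rep.{0} ℤ G) (i : ℤ) {A B : Rep.{0} ℤ G} (φ : A ⟶ B)
    (z : tate i (hRep X (hRep (IGrep G) A))) :
    tmap (i + 1) (pr1 X B)
        (cup (tmap i ((Rep.ihom X).map ((Rep.ihom (IGrep G)).map φ)) z) (fcls G)) =
      tmap (i + 1) ((Rep.ihom X).map φ) (tmap (i + 1) (pr1 X A) (cup z (fcls G))) := by
  rw [cup_fcls, cup_fcls]
  obtain ⟨f, hf, rfl⟩ := tate0mk_surj z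
  have key : FL (J G i) X B (((Rep.ihom (J G i)).map ((Rep.ihom X).map ((Rep.ihom (IGrep G)).map φ))).hom f) =
    ((Rep.ihom (J G i ⊗ (𝟙_ (Rep ℤ G) ⊗ IGrep G))).map ((Rep.ihom X).map φ)).hom (FL (J G i) X A f) :=
    hom_ext3 _ _ fun q a x y => rfl
  refine (tate0mk_eq_iff _ _ _ _).mpr ⟨0, ?_⟩
  rw [map_zero, eq_comm, sub_eq_zero]
  exact congrArg (preL (μ G i 1) (hRep X B)) key
end Enc

open CategoryTheory MonoidalCategory Enc

theorem statement1 (G : Type) [Group G] [Fintype G] :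
    ∃ c : tate 1 (IGrep G), ∀ (X : Rep ℤ G) (i : ℤ),
      (∀ {A B : Rep ℤ G} (φ : A ⟶ B) (z : tate i (hRep X (hRep (IGrep G) A))),
          tmap (i + 1) (pr1 X B)
              (cup (tmap i ((Rep.ihom X).map ((Rep.ihom (IGrep G)).map φ)) z) c) =
            tmap (i + 1) ((Rep.ihom X).map φ) (tmap (i + 1) (pr1 X A) (cup z c))) ∧
      ∀ A : Rep ℤ G,
        Function.Bijective
          (fun z : tate i (hRep X (hRep (IGrep G) A)) => tmap (i + 1) (pr1 X A) (cup z c)) :=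
  ⟨fcls G, fun X i => ⟨fun φ z => fcls_nat X i φ z, fun A => fcls_bij X A i⟩⟩
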